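/- Let X be an infinite Tychonoff space. If C_p^2(X) has a discrete point-separating subspace, then s(σ_X) ≥ iw(X), i.e., the σ-product σ_X of the countable power X^ω has discrete subspaces of every cardinality below iw(X) (its spread is at least the i-weight of X). -/

import Mathlib

open Cardinal Set

universe u

/-- `C_p(X)`: continuous real-valued functions with the topology of pointwise
convergence (subspace of the product `X → ℝ`). -/
def Cp (X : Type u) [TopologicalSpace X] : Type u := {f : X → ℝ // Continuous f}

instance (X : Type u) [TopologicalSpace X] : TopologicalSpace (Cp X) :=
  inferInstanceAs (TopologicalSpace {f : X → ℝ // Continuous f})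

/-- The spread of a space: the supremum of cardinalities of its discrete subspaces. -/
noncomputable def spread (Y : Type u) [TopologicalSpace Y] : Cardinal.{u} :=
  ⨆ D : {D : Set Y // DiscreteTopology ↥D}, #↥D.1

/-- The weight of a space: the least cardinality of a topological basis. -/
noncomputable def weight (X : Type u) [TopologicalSpace X] : Cardinal.{u} :=
  ⨅ B : {B : Set (Set X) // TopologicalSpace.IsTopologicalBasis B}, #↥B.1

/-- The i-weight of a space: the least weight of a coarser Tychonoff topology on the
same underlying set. -/
noncomputable def iweight (X : Type u) [t : TopologicalSpace X] : Cardinal.{u} :=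
  ⨅ t' : {t' : TopologicalSpace X // t ≤ t' ∧ @T35Space X t'}, @weight X t'.1

/-- The σ-product of `X^ω` with basepoint `b`: all points of the countable power
differing from `b` in at most finitely many coordinates. -/
def sigmaProd (X : Type u) [TopologicalSpace X] (b : ℕ → X) : Set (ℕ → X) :=
  {y | {n | y n ≠ b n}.Finite}

/-- A set of pairs of continuous functions separates points of `X`. -/
def PointSep2 {X : Type u} [TopologicalSpace X] (F : Set (Cp X × Cp X)) : Prop :=
  ∀ x y : X, x ≠ y → ∃ p ∈ F, p.1.1 x ≠ p.1.1 y ∨ p.2.1 x ≠ p.2.1 y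

/-- A set of continuous functions separates points of `X`. -/
def PointSep1 {X : Type u} [TopologicalSpace X] (F : Set (Cp X)) : Prop :=
  ∀ x y : X, x ≠ y → ∃ f ∈ F, f.1 x ≠ f.1 y

/-- A point-separating set in `C_p^m(X)`. -/
def PointSepM {X : Type u} [TopologicalSpace X] {m : ℕ} (F : Set (Fin m → Cp X)) : Prop :=
  ∀ x y : X, x ≠ y → ∃ f ∈ F, ∃ i, (f i).1 x ≠ (f i).1 y

/-- A functionally closed set (zero-set). -/
def FunctionallyClosed {X : Type u} [TopologicalSpace X] (A : Set X) : Prop :=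
  ∃ g : X → ℝ, Continuous g ∧ A = g ⁻¹' {0}

/-- Zero-dimensionality in the sense of covering dimension (`dim X = 0`): any two disjoint
functionally closed sets are separated by a clopen set. -/
def ZeroDimensional (X : Type u) [TopologicalSpace X] : Prop :=
  ∀ A B : Set X, FunctionallyClosed A → FunctionallyClosed B → Disjoint A B →
    ∃ U : Set X, IsClopen U ∧ A ⊆ U ∧ Disjoint U B

open Topology in
lemma iweight_le_aux {X : Type u} [t : TopologicalSpace X] {ι : Type u} (g : ι → X → ℝ × ℝ)
    (hg : ∀ i, Continuous (g i)) (hsep : ∀ x y, x ≠ y → ∃ i, g i x ≠ g i y) :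
    iweight X ≤ max #ι ℵ₀ := by
  classical
  let e : X → (ι → ℝ × ℝ) := fun x i => g i x
  have he : Continuous e := continuous_pi hg
  have hinj : Function.Injective e := by
    intro x y h
    by_contra hne
    obtain ⟨i, hi⟩ := hsep x y hne
    exact hi (congrFun h i)
  let t' : TopologicalSpace X := TopologicalSpace.induced e inferInstance
  have h1 : t ≤ t' := continuous_iff_le_induced.1 he
  have h2 : @T35Space X t' := by
    have : @IsEmbedding X _ t' _ e := @IsEmbedding.mk X _ t' _ e (@IsInducing.mk X _ t' _ e rfl) hinj
    exact @IsEmbedding.t35Space X t' _ _ _ e this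
  let K := ι × TopologicalSpace.countableBasis (ℝ × ℝ)
  let S : K → Set X := fun a => g a.1 ⁻¹' a.2.1
  have hgen : t' = TopologicalSpace.generateFrom (range S) := by
    have ha : t' = ⨅ i, TopologicalSpace.induced (g i) inferInstance := by
      change TopologicalSpace.induced e (⨅ i, TopologicalSpace.induced _ _) = _
      rw [induced_iInf]
      simp only [induced_compose]
      rfl
    have hb : ∀ i, TopologicalSpace.induced (g i) (inferInstance : TopologicalSpace (ℝ × ℝ)) =
        TopologicalSpace.generateFrom (preimage (g i) '' TopologicalSpace.countableBasis (ℝ × ℝ)) := by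
      intro i
      conv_lhs => rw [TopologicalSpace.eq_generateFrom_countableBasis (ℝ × ℝ)]
      exact induced_generateFrom_eq
    rw [ha]
    simp only [hb]
    rw [← generateFrom_iUnion]
    congr 1
    ext s
    simp [S, K]
  have hbasis := @TopologicalSpace.isTopologicalBasis_of_subbasis X t' _ hgen
  have hK : #(Finset K) ≤ max #ι ℵ₀ := by
    have hK' : #K ≤ max #ι ℵ₀ := by
      have : #(TopologicalSpace.countableBasis (ℝ × ℝ)) ≤ ℵ₀ :=
        (TopologicalSpace.countable_countableBasis _).le_aleph0
      simp only [K, mk_prod, lift_uzero]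
      refine (mul_le_max _ _).trans ?_
      simp only [max_le_iff, le_max_left, le_max_right, and_true, true_and]
      exact le_max_of_le_right (by simpa using this)
    rcases finite_or_infinite K with h | h
    · exact (mk_le_aleph0).trans (le_max_right _ _)
    · rw [mk_finset_of_infinite]; exact hK'
  have hsub : ((fun f => ⋂₀ f) '' {f : Set (Set X) | f.Finite ∧ f ⊆ range S}) ⊆
      range (fun s : Finset K => ⋂₀ (S '' (s : Set K))) := by
    rintro _ ⟨f, ⟨hf, hfs⟩, rfl⟩
    obtain ⟨f, rfl⟩ := hf.exists_finset_coe
    rw [← image_univ, Finset.subset_set_image_iff] at hfs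
    obtain ⟨s', -, rfl⟩ := hfs
    exact ⟨s', by simp⟩
  calc @iweight X t ≤ @weight X t' :=
        ciInf_le' (fun t' : {t' : TopologicalSpace X // t ≤ t' ∧ @T35Space X t'} => @weight X t'.1)
          ⟨t', h1, h2⟩
    _ ≤ _ := ciInf_le' (fun B : {B : Set (Set X) // @TopologicalSpace.IsTopologicalBasis X t' B} =>
          #↥B.1) ⟨_, hbasis⟩
    _ ≤ _ := mk_le_mk_of_subset hsub
    _ ≤ _ := mk_range_le
    _ ≤ _ := hK

lemma le_spread_aux {Y : Type u} [TopologicalSpace Y] (D : Set Y) (hD : DiscreteTopology ↥D) :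
    #D ≤ spread Y :=
  le_ciSup (f := fun D : {D : Set Y // DiscreteTopology ↥D} => #↥D.1)
    (bddAbove_range _) ⟨D, hD⟩

open Topology in
lemma isolate_aux {X : Type u} [TopologicalSpace X] (F : Set (Cp X × Cp X))
    (hF : DiscreteTopology ↥F) (p : F) :
    ∃ (I : Set X) (V : X → TopologicalSpace.countableBasis (ℝ × ℝ)), I.Finite ∧
      (∀ x, (p.1.1.1 x, p.1.2.1 x) ∈ (V x).1) ∧
      ∀ q : F, (∀ x ∈ I, (q.1.1.1 x, q.1.2.1 x) ∈ (V x).1) → q = p := by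
  let Φ : Cp X × Cp X → (X → ℝ × ℝ) := fun p x => (p.1.1 x, p.2.1 x)
  have hΦ : IsInducing Φ := by
    have h1 : IsInducing (fun f : Cp X => f.1) := ⟨rfl⟩
    have h2 := h1.prodMap h1
    let c : (X → ℝ × ℝ) → (X → ℝ) × (X → ℝ) := fun h => (fun x => (h x).1, fun x => (h x).2)
    have hc : Continuous c := by fun_prop
    have hΦc : Continuous Φ := by
      have ha : Continuous (fun f : Cp X => f.1) := h1.continuous
      refine continuous_pi fun x => ?_
      exact ((continuous_apply x).comp (ha.comp continuous_fst)).prodMk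
        ((continuous_apply x).comp (ha.comp continuous_snd))
    exact IsInducing.of_comp hΦc hc h2
  have hΨ : IsInducing (fun q : F => Φ q.1) := hΦ.comp IsInducing.subtypeVal
  have hmem : ({p} : Set F) ∈ 𝓝 p := (isOpen_discrete _).mem_nhds rfl
  rw [hΨ.nhds_eq_comap, nhds_pi, Filter.mem_comap] at hmem
  obtain ⟨s, hs, hsp⟩ := hmem
  obtain ⟨I, hI, W, hW, hWs⟩ := Filter.mem_pi.1 hs
  have : ∀ x, ∃ V : TopologicalSpace.countableBasis (ℝ × ℝ), Φ p.1 x ∈ V.1 ∧ V.1 ⊆ W x := by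
    intro x
    obtain ⟨V, hV, h1, h2⟩ :=
      (TopologicalSpace.isBasis_countableBasis (ℝ × ℝ)).mem_nhds_iff.1 (hW x)
    exact ⟨⟨V, hV⟩, h1, h2⟩
  choose V hV1 hV2 using this
  refine ⟨I, V, hI, hV1, fun q hq => ?_⟩
  exact hsp (hWs fun x hx => hV2 x (hq x hx))

lemma card_aux {X : Type u} [TopologicalSpace X] (F : Set (Cp X × Cp X))
    (hF : DiscreteTopology ↥F) (b : ℕ → X) :
    #F ≤ ℵ₀ * spread ↥(sigmaProd X b) := by
  classical
  let C := Σ n : ℕ, (Fin n → TopologicalSpace.countableBasis (ℝ × ℝ))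
  have hdata : ∀ p : F, ∃ (c : C) (y : sigmaProd X b),
      (∀ k : Fin c.1, (p.1.1.1 (y.1 k), p.1.2.1 (y.1 k)) ∈ (c.2 k).1) ∧
      ∀ q : F, (∀ k : Fin c.1, (q.1.1.1 (y.1 k), q.1.2.1 (y.1 k)) ∈ (c.2 k).1) → q = p := by
    intro p
    obtain ⟨I, V, hI, h1, h2⟩ := isolate_aux F hF p
    obtain ⟨n, z, -, rfl⟩ := hI.fin_param
    refine ⟨⟨n, fun k => V (z k)⟩, ⟨fun k => if h : k < n then z ⟨k, h⟩ else b k, ?_⟩, ?_, ?_⟩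
    · refine (Set.finite_lt_nat n).subset fun k hk => ?_
      by_contra hkn
      exact hk (dif_neg hkn)
    · intro k
      simpa using h1 (z k)
    · intro q hq
      refine h2 q ?_
      rintro _ ⟨k, rfl⟩
      simpa using hq k
  choose c y h1 h2 using hdata
  have hpiece : ∀ a : C, #{p : F | c p = a} ≤ spread ↥(sigmaProd X b) := by
    intro a
    have hinj : InjOn y {p : F | c p = a} := by
      intro p hp q hq hpq
      refine h2 q p fun k => ?_
      have := h1 p
      simp only [mem_setOf_eq] at hp hq
      rw [hp, hpq, ← hq] at this
      exact this k
    rw [← mk_image_eq_of_injOn _ _ hinj]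
    apply le_spread_aux
    rw [discreteTopology_iff_isOpen_singleton]
    rintro ⟨_, p, hp, rfl⟩
    have hopen : IsOpen {w : sigmaProd X b |
        ∀ k : Fin a.1, (p.1.1.1 (w.1 k), p.1.2.1 (w.1 k)) ∈ (a.2 k).1} := by
      simp only [setOf_forall]
      refine isOpen_iInter_of_finite fun k => ?_
      have hk : Continuous (fun w : sigmaProd X b => w.1 (k : ℕ)) :=
        (continuous_apply _).comp continuous_subtype_val
      exact ((TopologicalSpace.isBasis_countableBasis (ℝ × ℝ)).isOpen (a.2 k).2).preimage
        ((p.1.1.2.comp hk).prodMk (p.1.2.2.comp hk))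
    rw [isOpen_induced_iff]
    refine ⟨_, hopen, ?_⟩
    ext ⟨_, q, hq, rfl⟩
    simp only [mem_setOf_eq] at hp hq
    subst hp
    simp only [mem_preimage, mem_setOf_eq, mem_singleton_iff]
    constructor
    · intro h
      have hpq := h2 q p (by rw [hq]; exact h)
      exact Subtype.ext (congrArg y hpq.symm)
    · intro h
      have hy : y q = y p := congrArg Subtype.val h
      rw [hy]
      exact h1 p
  have hC : #C ≤ ℵ₀ := by
    have : Countable C := inferInstance
    exact mk_le_aleph0
  have hU : (⋃ a : C, {p : F | c p = a}) = Set.univ := by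
    ext p; simp
  have := mk_iUnion_le_lift (fun a : C => {p : F | c p = a})
  rw [hU, mk_univ, lift_uzero] at this
  simp only [lift_uzero] at this
  refine this.trans (mul_le_mul' ?_ (ciSup_le' hpiece))
  simpa using hC

/-- If `C_p^2(X)` has a discrete point-separating subspace, then `s(σ_X) ≥ iw(X)`. -/
theorem stmt3 {X : Type u} [TopologicalSpace X] [T35Space X] [Infinite X]
    (hF : ∃ F : Set (Cp X × Cp X), DiscreteTopology ↥F ∧ PointSep2 F) :
    ∀ b : ℕ → X, iweight X ≤ spread ↥(sigmaProd X b) := by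
  classical
  intro b
  obtain ⟨F, hd, hs⟩ := hF
  have hinf : Infinite (sigmaProd X b) := by
    refine Infinite.of_injective (fun x : X => (⟨Function.update b 0 x, ?_⟩ : sigmaProd X b)) ?_
    · refine (finite_singleton 0).subset fun k hk => ?_
      by_contra h
      exact hk (Function.update_of_ne h _ _)
    · intro x y h
      have := congrFun (congrArg Subtype.val h) 0
      simpa using this
  have hω : ℵ₀ ≤ spread ↥(sigmaProd X b) := by
    obtain ⟨s, hs, hds⟩ := exists_infinite_discreteTopology (sigmaProd X b)
    exact (infinite_iff.1 hs.to_subtype).trans (le_spread_aux s hds)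
  have h1 := iweight_le_aux (fun (p : F) x => (p.1.1.1 x, p.1.2.1 x))
    (fun p => p.1.1.2.prodMk p.1.2.2) (by
      intro x y hxy
      obtain ⟨p, hp, h⟩ := hs x y hxy
      refine ⟨⟨p, hp⟩, fun he => ?_⟩
      rw [Prod.mk.injEq] at he
      exact h.elim (fun h => h he.1) (fun h => h he.2))
  refine h1.trans (max_le ?_ hω)
  refine (card_aux F hd b).trans ?_
  rw [mul_eq_right hω hω (by exact aleph0_ne_zero)]
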